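/- arXiv:2506.11780 — 3 statements merged into one kernel-verified Lean document; each statement's English description precedes it below -/
import Mathlib

section
/- Let ε > 0 and let ζ : ℝ → ℝ be continuous with −1 ≤ ζ(t) ≤ 3 for all t ≥ 0. Suppose u, v : ℝ → ℝ are differentiable and satisfy the scaled transverse Floquet system u̇(t) = −u(t) − ζ(t)·v(t), v̇(t) = ε·(u(t) − v(t)) for all t ≥ 0. Then L(t) = ε·u(t)² + v(t)² is nonincreasing on [0,∞); in particular ε·u(t)² + v(t)² ≤ ε·u(0)² + v(0)² for all t ≥ 0. -/
/-- If `-1 ≤ ζ(t) ≤ 3` for `t ≥ 0`, then along solutions of the scaled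
transverse Floquet system the Liapunov function `L(t) = ε u(t)² + v(t)²`
is nonincreasing on `[0,∞)`; in particular `L(t) ≤ L(0)` for `t ≥ 0`. -/
theorem stmt_4 (ε : ℝ) (hε : 0 < ε) (ζ : ℝ → ℝ) (hζ : Continuous ζ)
    (hζ₁ : ∀ t : ℝ, 0 ≤ t → -1 ≤ ζ t) (hζ₂ : ∀ t : ℝ, 0 ≤ t → ζ t ≤ 3)
    (u v : ℝ → ℝ) (hu' : Differentiable ℝ u) (hv' : Differentiable ℝ v)
    (hu : ∀ t : ℝ, 0 ≤ t → HasDerivAt u (-u t - ζ t * v t) t)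
    (hv : ∀ t : ℝ, 0 ≤ t → HasDerivAt v (ε * (u t - v t)) t) :
    AntitoneOn (fun t => ε * u t ^ 2 + v t ^ 2) (Set.Ici (0 : ℝ)) ∧
    ∀ t : ℝ, 0 ≤ t → ε * u t ^ 2 + v t ^ 2 ≤ ε * u 0 ^ 2 + v 0 ^ 2 := by
  have hd : ∀ t : ℝ, 0 ≤ t → HasDerivAt (fun t => ε * u t ^ 2 + v t ^ 2)
      (-(2 * ε * ((ζ t + 1) / 4 * (u t + v t) ^ 2 + (3 - ζ t) / 4 * (u t - v t) ^ 2))) t := by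
    intro t ht
    have h := (((hu t ht).pow 2).const_mul ε).add ((hv t ht).pow 2)
    refine h.congr_deriv ?_
    push_cast
    ring
  have hanti : AntitoneOn (fun t => ε * u t ^ 2 + v t ^ 2) (Set.Ici (0 : ℝ)) := by
    apply antitoneOn_of_deriv_nonpos (convex_Ici 0)
    · exact fun t ht => (hd t ht).continuousAt.continuousWithinAt
    · intro t ht
      exact (hd t (interior_subset ht)).differentiableAt.differentiableWithinAt
    · intro t ht
      have h0 : 0 ≤ t := interior_subset ht
      rw [(hd t h0).deriv]
      have h1 : 0 ≤ ζ t + 1 := by linarith [hζ₁ t h0]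
      have h2 : 0 ≤ 3 - ζ t := by linarith [hζ₂ t h0]
      exact neg_nonpos.mpr (by positivity)
  exact ⟨hanti, fun t ht => hanti (Set.mem_Ici.mpr le_rfl) ht ht⟩
end

section
/- Let ε be a real number with 0 < ε ≤ 4 and let ζ : ℝ → ℝ be continuous with (2 − √(3(4−ε)))/2 ≤ ζ(t) ≤ (2 + √(3(4−ε)))/2 for all t ≥ 0. Suppose u, v : ℝ → ℝ are differentiable and satisfy the scaled transverse Floquet system u̇(t) = −u(t) − ζ(t)·v(t), v̇(t) = ε·(u(t) − v(t)) for all t ≥ 0. Then L(t) = ε·u(t)² + v(t)² satisfies L̇(t) + (ε/2)·L(t) ≤ 0 for all t ≥ 0, and consequently ε·u(t)² + v(t)² ≤ (ε·u(0)² + v(0)²)·exp(−(ε/2)·t) for all t ≥ 0. -/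
/-- If `0 < ε ≤ 4` and `(2 - √(3(4-ε)))/2 ≤ ζ(t) ≤ (2 + √(3(4-ε)))/2` for
`t ≥ 0`, then along solutions of the scaled transverse Floquet system the
Liapunov function `L(t) = ε u(t)² + v(t)²` satisfies `L̇ + (ε/2) L ≤ 0`,
and consequently `L(t) ≤ L(0) exp(-(ε/2) t)` for all `t ≥ 0`. -/
theorem stmt_6 (ε : ℝ) (hε : 0 < ε) (hε4 : ε ≤ 4) (ζ : ℝ → ℝ) (hζ : Continuous ζ)
    (hζ₁ : ∀ t : ℝ, 0 ≤ t → (2 - Real.sqrt (3 * (4 - ε))) / 2 ≤ ζ t)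
    (hζ₂ : ∀ t : ℝ, 0 ≤ t → ζ t ≤ (2 + Real.sqrt (3 * (4 - ε))) / 2)
    (u v : ℝ → ℝ) (hu' : Differentiable ℝ u) (hv' : Differentiable ℝ v)
    (hu : ∀ t : ℝ, 0 ≤ t → HasDerivAt u (-u t - ζ t * v t) t)
    (hv : ∀ t : ℝ, 0 ≤ t → HasDerivAt v (ε * (u t - v t)) t) :
    (∀ t : ℝ, 0 ≤ t →
      deriv (fun s => ε * u s ^ 2 + v s ^ 2) t
        + (ε / 2) * (ε * u t ^ 2 + v t ^ 2) ≤ 0) ∧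
    (∀ t : ℝ, 0 ≤ t →
      ε * u t ^ 2 + v t ^ 2 ≤ (ε * u 0 ^ 2 + v 0 ^ 2) * Real.exp (-(ε / 2) * t)) := by
  have hL : ∀ t : ℝ, 0 ≤ t → HasDerivAt (fun s => ε * u s ^ 2 + v s ^ 2)
      (ε * (2 * u t * (-u t - ζ t * v t)) + 2 * v t * (ε * (u t - v t))) t := by
    intro t ht
    have h := (((hu t ht).pow 2).const_mul ε).add ((hv t ht).pow 2)
    exact HasDerivAt.congr_deriv (f := fun s => ε * u s ^ 2 + v s ^ 2) h (by norm_num)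
  have key : ∀ t : ℝ, 0 ≤ t →
      (ε * (2 * u t * (-u t - ζ t * v t)) + 2 * v t * (ε * (u t - v t)))
        + (ε / 2) * (ε * u t ^ 2 + v t ^ 2) ≤ 0 := by
    intro t ht
    have h1 := hζ₁ t ht
    have h2 := hζ₂ t ht
    have hs : Real.sqrt (3 * (4 - ε)) ^ 2 = 3 * (4 - ε) := Real.sq_sqrt (by linarith)
    have hw : (1 - ζ t) ^ 2 ≤ 3 * (4 - ε) / 4 := by
      nlinarith [mul_nonneg (sub_nonneg.2 h1) (sub_nonneg.2 h2)]
    have hq : 0 ≤ (2 - ε / 2) * u t ^ 2 - 2 * (1 - ζ t) * (u t * v t) + 3 / 2 * v t ^ 2 := by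
      nlinarith [sq_nonneg (3 / 2 * v t - (1 - ζ t) * u t),
        mul_nonneg (sub_nonneg.2 hw) (sq_nonneg (u t))]
    have := mul_nonneg hε.le hq
    linarith
  refine ⟨fun t ht => by rw [(hL t ht).deriv]; exact key t ht, fun t ht => ?_⟩
  have hF : ∀ t : ℝ, 0 ≤ t →
      HasDerivAt (fun s => (ε * u s ^ 2 + v s ^ 2) * Real.exp (ε / 2 * s))
      (((ε * (2 * u t * (-u t - ζ t * v t)) + 2 * v t * (ε * (u t - v t)))
        + (ε / 2) * (ε * u t ^ 2 + v t ^ 2)) * Real.exp (ε / 2 * t)) t := by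
    intro t ht
    have h := (hL t ht).mul (((hasDerivAt_id t).const_mul (ε / 2)).exp)
    exact HasDerivAt.congr_deriv
      (f := fun s => (ε * u s ^ 2 + v s ^ 2) * Real.exp (ε / 2 * s)) h
      (by simp only [id]; ring)
  have hanti : AntitoneOn (fun s => (ε * u s ^ 2 + v s ^ 2) * Real.exp (ε / 2 * s))
      (Set.Ici 0) := by
    refine antitoneOn_of_deriv_nonpos (convex_Ici 0)
      (fun s hs => (hF s hs).continuousAt.continuousWithinAt)
      (fun s hs => (hF s (interior_subset hs)).differentiableAt.differentiableWithinAt)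
      (fun s hs => ?_)
    rw [(hF s (interior_subset hs)).deriv]
    exact mul_nonpos_of_nonpos_of_nonneg (key s (interior_subset hs)) (Real.exp_pos _).le
  have h := hanti (Set.mem_Ici.2 le_rfl) (Set.mem_Ici.2 ht) ht
  simp only [mul_zero, Real.exp_zero, mul_one] at h
  rw [neg_mul, Real.exp_neg, ← div_eq_mul_inv, le_div_iff₀ (Real.exp_pos _)]
  exact h
end

section
/- Let ε > 0 and let ζ : ℝ → ℝ be continuous with (1 − 2√ε)/ε ≤ ζ(t) ≤ (1 + 2√ε)/ε for all t ≥ 0. Suppose u, v : ℝ → ℝ are differentiable and satisfy the scaled transverse Floquet system u̇(t) = −u(t) − ζ(t)·v(t), v̇(t) = ε·(u(t) − v(t)) for all t ≥ 0. Then L(t) = ε²·u(t)² + v(t)² is nonincreasing on [0,∞); in particular ε²·u(t)² + v(t)² ≤ ε²·u(0)² + v(0)² for all t ≥ 0. -/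
/-- If `(1 - 2√ε)/ε ≤ ζ(t) ≤ (1 + 2√ε)/ε` for `t ≥ 0`, then along solutions
of the scaled transverse Floquet system the second Liapunov function
`L(t) = ε² u(t)² + v(t)²` is nonincreasing on `[0,∞)`; in particular
`L(t) ≤ L(0)` for `t ≥ 0`. -/
theorem stmt_9 (ε : ℝ) (hε : 0 < ε) (ζ : ℝ → ℝ) (hζ : Continuous ζ)
    (hζ₁ : ∀ t : ℝ, 0 ≤ t → (1 - 2 * Real.sqrt ε) / ε ≤ ζ t)
    (hζ₂ : ∀ t : ℝ, 0 ≤ t → ζ t ≤ (1 + 2 * Real.sqrt ε) / ε)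
    (u v : ℝ → ℝ) (hu' : Differentiable ℝ u) (hv' : Differentiable ℝ v)
    (hu : ∀ t : ℝ, 0 ≤ t → HasDerivAt u (-u t - ζ t * v t) t)
    (hv : ∀ t : ℝ, 0 ≤ t → HasDerivAt v (ε * (u t - v t)) t) :
    AntitoneOn (fun t => ε^2 * u t ^ 2 + v t ^ 2) (Set.Ici (0 : ℝ)) ∧
    ∀ t : ℝ, 0 ≤ t → ε^2 * u t ^ 2 + v t ^ 2 ≤ ε^2 * u 0 ^ 2 + v 0 ^ 2 := by
  have hd : ∀ t : ℝ, 0 ≤ t → HasDerivAt (fun t => ε^2 * u t ^ 2 + v t ^ 2)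
      (ε^2 * (2 * u t * (-u t - ζ t * v t)) + 2 * v t * (ε * (u t - v t))) t := by
    intro t ht
    have h := (((hu t ht).fun_pow 2).const_mul (ε^2)).fun_add ((hv t ht).fun_pow 2)
    refine h.congr_deriv ?_
    norm_num
  have hanti : AntitoneOn (fun t => ε^2 * u t ^ 2 + v t ^ 2) (Set.Ici (0 : ℝ)) := by
    apply antitoneOn_of_deriv_nonpos (convex_Ici 0)
    · exact fun t ht => (hd t ht).continuousAt.continuousWithinAt
    · intro t ht
      exact (hd t (interior_subset ht)).differentiableAt.differentiableWithinAt
    · intro t ht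
      have ht0 : 0 ≤ t := interior_subset ht
      rw [(hd t ht0).deriv]
      have h1 := hζ₁ t ht0
      have h2 := hζ₂ t ht0
      rw [div_le_iff₀ hε] at h1
      rw [le_div_iff₀ hε] at h2
      have hs := Real.sq_sqrt hε.le
      have hw : (1 - ζ t * ε) ^ 2 ≤ 4 * ε := by
        have : (1 - ζ t * ε) ^ 2 ≤ (2 * Real.sqrt ε) ^ 2 :=
          sq_le_sq' (by linarith) (by linarith)
        nlinarith
      have h3 := mul_nonneg (sub_nonneg.2 hw) (sq_nonneg (v t))
      nlinarith [sq_nonneg (ε * u t - (1 - ζ t * ε) * v t / 2)]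
  exact ⟨hanti, fun t ht => hanti (Set.mem_Ici.2 le_rfl) ht ht⟩
end
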